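/- Let (R,m) be a Noetherian local ring, I an ideal, N a finitely generated R-module, k ≥ -1 an integer, and r = depth_k(I,N) < ∞. Let x_1,...,x_r be an N-sequence in dimension > k contained in √I, and let a_1,...,a_s be generators of I. Then for all positive integers t and all s-tuples (t_1,...,t_s) of positive integers and all l ≤ r: ⋃_{j≤l} Ass_R(Ext^j_R(R/I^t, N))_{≥k} = ⋃_{j≤l} (Ass_R(N/(x_1,...,x_j)N))_{≥k} ∩ V(I) = ⋃_{j≤l} Ass_R(Ext^j_R(R/(a_1^{t_1},...,a_s^{t_s}), N))_{≥k}. -/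

import Mathlib

open CategoryTheory Opposite IsLocalRing

/-- Interpretation of an integer `k ≥ -1` in `WithBot ℕ∞`, for comparison with Krull dimensions. -/
noncomputable def zdim (k : ℤ) : WithBot (WithTop ℕ) :=
  if k < 0 then ⊥ else ((k.toNat : WithTop ℕ) : WithBot (WithTop ℕ))

/-- The ideal generated by the first `j` entries of the sequence `x`. -/
def prefIdeal {R : Type} [CommRing R] {r : ℕ} (x : Fin r → R) (j : ℕ) : Ideal R :=
  Ideal.span (x '' {i | (i : ℕ) < j})

/-- `x` is an `N`-sequence in dimension `> k`: for each `i`, `x i` avoids every associated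
prime `p` of `N/(x_0,…,x_{i-1})N` with `dim(R/p) > k`. -/
def IsSeqInDimGT (R : Type) [CommRing R] (N : Type) [AddCommGroup N] [Module R N]
    (k : ℤ) {r : ℕ} (x : Fin r → R) : Prop :=
  ∀ i : Fin r, ∀ p ∈ associatedPrimes R (N ⧸ (prefIdeal x (i : ℕ) • ⊤ : Submodule R N)),
    zdim k < ringKrullDim (R ⧸ p) → x i ∉ p

/-- `depth_k(I,N)`: the common length of maximal `N`-sequences in dimension `> k`
contained in `I` (realized as the supremum of lengths of such sequences). -/
noncomputable def depthK (R : Type) [CommRing R] (k : ℤ) (I : Ideal R)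
    (N : Type) [AddCommGroup N] [Module R N] : ℕ∞ :=
  sSup {n : ℕ∞ | ∃ (r : ℕ) (x : Fin r → R),
    (∀ i, x i ∈ I) ∧ IsSeqInDimGT R N k x ∧ n = (r : ℕ∞)}

/-- The set of prime (or arbitrary) ideals `p` with `dim(R/p) ≥ k`. -/
def dimGE (R : Type) [CommRing R] (k : ℤ) : Set (Ideal R) :=
  {p | zdim k ≤ ringKrullDim (R ⧸ p)}

section HomComplex

variable {R : Type} [CommRing R]

/-- The cochain complex `Hom(X, Y)` as a functor of `Y`. -/
noncomputable def homComplex (X : ChainComplex (ModuleCat.{0} R) ℕ) :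
    ModuleCat.{0} R ⥤ CochainComplex (ModuleCat.{0} R) ℕ where
  obj Y := X.linearYonedaObj R Y
  map f :=
    { f := fun i => ((linearYoneda R (ModuleCat.{0} R)).map f).app (op (X.X i))
      comm' := fun i j _ => (((linearYoneda R (ModuleCat.{0} R)).map f).naturality (X.d j i).op).symm }
  map_id Y := by
    ext i : 1
    exact congrArg (NatTrans.app · _) ((linearYoneda R (ModuleCat.{0} R)).map_id Y)
  map_comp f g := by
    ext i : 1
    exact congrArg (NatTrans.app · _) ((linearYoneda R (ModuleCat.{0} R)).map_comp f g)

variable (X : ChainComplex (ModuleCat.{0} R) ℕ)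

instance : (homComplex X).Additive where
  map_add {Y Z f g} := by
    ext i h : 3
    exact Preadditive.comp_add _ _ _ h f g

instance : (homComplex X).Linear R where
  map_smul {Y Z} f r := by
    ext i h : 3
    exact Linear.comp_smul _ _ _ h r f

/-- The cohomology of `Hom(X, Y)` in degree `n`, as a functor of `Y`. -/
noncomputable abbrev homCohomology (n : ℕ) : ModuleCat.{0} R ⥤ ModuleCat.{0} R :=
  homComplex X ⋙ HomologicalComplex.homologyFunctor _ _ n

lemma homologyMap_smul_id (K : CochainComplex (ModuleCat.{0} R) ℕ) (r : R) (n : ℕ) :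
    HomologicalComplex.homologyMap (r • 𝟙 K) n = r • 𝟙 (K.homology n) := by
  rw [← HomologicalComplex.homologyMap_id]
  exact ShortComplex.homologyMap_smul
    ((HomologicalComplex.shortComplexFunctor (ModuleCat.{0} R) (ComplexShape.up ℕ) n).map (𝟙 K)) r

lemma homCohomology_map_smul_id (Y : ModuleCat.{0} R) (r : R) (n : ℕ) :
    (homCohomology X n).map (r • 𝟙 Y) = r • 𝟙 _ := by
  simp only [homCohomology, Functor.comp_map, HomologicalComplex.homologyFunctor_map,
    Functor.map_smul]
  exact homologyMap_smul_id _ r n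

lemma homComplex_shortExact [∀ i, Projective (X.X i)] {S : ShortComplex (ModuleCat.{0} R)}
    (hS : S.ShortExact) : (S.map (homComplex X)).ShortExact := by
  refine HomologicalComplex.shortExact_of_degreewise_shortExact _ fun i => ?_
  have := hS.mono_f
  have := hS.epi_g
  refine { exact := ?_, mono_f := ?_, epi_g := ?_ }
  · rw [ShortComplex.moduleCat_exact_iff]
    intro (g : X.X i ⟶ S.X₂) hg
    exact ⟨hS.exact.lift g hg, hS.exact.lift_f g hg⟩
  · rw [ModuleCat.mono_iff_injective]
    intro (g : X.X i ⟶ S.X₁) (g' : X.X i ⟶ S.X₁) h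
    exact (cancel_mono S.f).1 h
  · rw [ModuleCat.epi_iff_surjective]
    intro (g : X.X i ⟶ S.X₃)
    exact ⟨Projective.factorThru g S.g, Projective.factorThru_comp g S.g⟩

/-- Precomposition with a map `X.X j ⟶ X.X i`. -/
noncomputable def homComplexPrecomp (Y : ModuleCat.{0} R) {i j : ℕ} (f : X.X j ⟶ X.X i) :
    ((homComplex X).obj Y).X i ⟶ ((homComplex X).obj Y).X j :=
  ((linearYoneda R (ModuleCat.{0} R)).obj Y).map f.op

/-- A homotopy from `r • 𝟙` to zero on `X` induces one on `Hom(X, Y)`. -/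
noncomputable def homotopySMulHomComplex {r : R} (h : Homotopy (r • 𝟙 X) 0) (Y : ModuleCat.{0} R) :
    Homotopy (r • 𝟙 ((homComplex X).obj Y)) 0 where
  hom i j := homComplexPrecomp X Y (h.hom j i)
  zero i j hij := by
    rw [h.zero j i hij]
    exact Functor.map_zero ((linearYoneda R (ModuleCat.{0} R)).obj Y) _ _
  comm i := by
    have hc := h.comm i
    have key (g : X.X i ⟶ Y) : (r • g : X.X i ⟶ Y) = (r • 𝟙 X : X ⟶ X).f i ≫ g := by
      simp
    cases i with
    | zero =>
      rw [Homotopy.prevD_chainComplex, Homotopy.dNext_zero_chainComplex, zero_add,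
        HomologicalComplex.zero_f, add_zero] at hc
      rw [Homotopy.dNext_cochainComplex, Homotopy.prevD_zero_cochainComplex, add_zero,
        HomologicalComplex.zero_f, add_zero]
      refine ModuleCat.hom_ext (LinearMap.ext fun (g : X.X _ ⟶ Y) => (key g).trans ?_)
      rw [hc, Category.assoc]
      rfl
    | succ n =>
      rw [Homotopy.prevD_chainComplex, Homotopy.dNext_succ_chainComplex,
        HomologicalComplex.zero_f, add_zero] at hc
      rw [Homotopy.dNext_cochainComplex, Homotopy.prevD_succ_cochainComplex,
        HomologicalComplex.zero_f, add_zero]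
      refine ModuleCat.hom_ext (LinearMap.ext fun (g : X.X _ ⟶ Y) => (key g).trans ?_)
      rw [hc, Preadditive.add_comp, Category.assoc, Category.assoc]
      exact add_comm _ _

variable {X}

lemma smul_homCohomology_eq_zero {T : ModuleCat.{0} R} (P : ProjectiveResolution T) {r : R}
    (hr : ∀ y : T, r • y = 0) (Y : ModuleCat.{0} R) (n : ℕ)
    (z : (homCohomology P.complex n).obj Y) : r • z = 0 := by
  have h₀ : r • P.π = 0 := by
    refine HomologicalComplex.hom_ext _ _ fun i => ?_
    cases i with
    | zero =>
      refine ModuleCat.hom_ext (LinearMap.ext fun y => ?_)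
      exact hr (P.π.f 0 y)
    | succ n => simp
  have h : Homotopy (r • 𝟙 P.complex) 0 :=
    ProjectiveResolution.liftHomotopy (P := P) (Q := P) 0 _ _ (by simp [h₀]) (by simp)
  have := (homotopySMulHomComplex _ h Y).homologyMap_eq n
  rw [homologyMap_smul_id, HomologicalComplex.homologyMap_zero] at this
  exact congrArg (fun f => f.hom z) this

/-- Degree zero cohomology consists of the homomorphisms. -/
lemma nonempty_homCohomology_zero_equiv {T : ModuleCat.{0} R} (P : ProjectiveResolution T)
    (Y : ModuleCat.{0} R) :
    Nonempty ((homCohomology P.complex 0).obj Y ≃ₗ[R] (T ⟶ Y)) := by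
  let K := P.complex.linearYonedaObj R Y
  let f : K.homology 0 ⟶ K.X 0 := K.isoHomologyπ₀.inv ≫ K.iCycles 0
  let π : P.complex.X 0 ⟶ T := P.π.f 0
  have hepi : Epi π := inferInstanceAs (Epi (P.π.f 0))
  have hπ : P.complex.d 1 0 ≫ π = 0 := P.complex_d_comp_π_f_zero
  let g : ModuleCat.of R (T ⟶ Y) ⟶ K.X 0 := ModuleCat.ofHom (Linear.leftComp R Y π)
  have hmono : Mono f := mono_comp _ _
  have hf : Function.Injective f.hom := (ModuleCat.mono_iff_injective _).1 hmono
  have hg : Function.Injective g.hom := fun a b h => (cancel_epi π).1 h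
  have hex : (ShortComplex.mk _ _ (K.iCycles_d 0 1)).Exact :=
    ShortComplex.exact_of_f_is_kernel _ (K.cyclesIsKernel 0 1 (by simp))
  have hrange : LinearMap.range f.hom = LinearMap.range g.hom := by
    ext (u : P.complex.X 0 ⟶ Y)
    constructor
    · rintro ⟨z, hz⟩
      have hu : P.complex.d 1 0 ≫ u = 0 := by
        have := congrArg (fun φ => φ.hom (K.isoHomologyπ₀.inv z)) (K.iCycles_d 0 1)
        subst hz
        exact this
      exact ⟨P.exact₀.desc u hu, P.exact₀.g_desc u hu⟩
    · rintro ⟨w, rfl⟩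
      have hd : K.d 0 1 (π ≫ w : P.complex.X 0 ⟶ Y) = 0 := by
        change P.complex.d 1 0 ≫ π ≫ w = 0
        rw [← Category.assoc, hπ, Limits.zero_comp]
      obtain ⟨c, hc⟩ := (ShortComplex.moduleCat_exact_iff _).1 hex _ hd
      refine ⟨K.isoHomologyπ₀.hom c, ?_⟩
      have := congrArg (fun φ => (φ ≫ K.iCycles 0).hom c) K.isoHomologyπ₀.hom_inv_id
      exact this.trans hc
  exact ⟨LinearEquiv.ofInjective f.hom hf ≪≫ₗ LinearEquiv.ofEq _ _ hrange ≪≫ₗ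
    (LinearEquiv.ofInjective g.hom hg).symm⟩

end HomComplex

section AssociatedPrimes

variable {R : Type} [CommRing R] {p : Ideal R}

lemma mem_associatedPrimes_iff_exists [IsNoetherianRing R] {M : Type*} [AddCommGroup M]
    [Module R M] :
    p ∈ associatedPrimes R M ↔ p.IsPrime ∧ ∃ y : M, ∀ r, r ∈ p ↔ r • y = 0 := by
  rw [AssociatedPrimes.mem_iff, isAssociatedPrime_iff]
  simp only [SetLike.ext_iff, Submodule.mem_colon_singleton, Submodule.mem_bot]

lemma mem_iff_smul_map_eq_zero [p.IsPrime] {E F : Type*} [AddCommGroup E] [Module R E]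
    [AddCommGroup F] [Module R F] (f : E →ₗ[R] F)
    (hf : ∀ y, f y = 0 → ∃ s ∉ p, s • y = 0) {y : E} (hy : ∀ r, r ∈ p ↔ r • y = 0) (r : R) :
    r ∈ p ↔ r • f y = 0 := by
  refine ⟨fun h => by rw [← map_smul, (hy r).1 h, map_zero], fun h => ?_⟩
  obtain ⟨s, hs, hsy⟩ := hf (r • y) (by rw [map_smul, h])
  rw [smul_smul, ← hy] at hsy
  exact (Ideal.IsPrime.mem_or_mem ‹_› hsy).resolve_left hs

lemma exists_mem_iff_smul_eq_zero_of_map [IsNoetherianRing R] [p.IsPrime] {E F : Type*}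
    [AddCommGroup E] [Module R E] [AddCommGroup F] [Module R F] (f : E →ₗ[R] F)
    (hf : ∀ y, f y = 0 → ∃ s ∉ p, s • y = 0) {y : E} (hy : ∀ r, r ∈ p ↔ r • f y = 0) :
    ∃ y' : E, ∀ r, r ∈ p ↔ r • y' = 0 := by
  obtain ⟨G, hG⟩ := (isNoetherianRing_iff_ideal_fg R).1 ‹_› p
  have h₁ (r : R) : ∃ s ∉ p, r ∈ G → s • r • y = 0 := by
    by_cases hr : r ∈ G
    · obtain ⟨s, hs, h⟩ := hf (r • y) (by rw [map_smul, ← hy, ← hG]; exact Ideal.subset_span hr)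
      exact ⟨s, hs, fun _ => h⟩
    · exact ⟨1, p.one_notMem, fun h => absurd h hr⟩
  choose σ hσ hσy using h₁
  have hs : ∏ r ∈ G, σ r ∉ p := fun h => by
    obtain ⟨r, -, hr⟩ := Ideal.IsPrime.prod_mem_iff.1 h
    exact hσ r hr
  refine ⟨(∏ r ∈ G, σ r) • y, fun r => ⟨fun hr => ?_, fun hr => ?_⟩⟩
  · have hle : p ≤ LinearMap.ker (LinearMap.toSpanSingleton R E ((∏ r ∈ G, σ r) • y)) := by
      rw [← hG, Submodule.span_le]
      intro r hr
      obtain ⟨c, hc⟩ := Finset.dvd_prod_of_mem σ hr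
      simp only [SetLike.mem_coe, LinearMap.mem_ker, LinearMap.toSpanSingleton_apply]
      rw [smul_comm, hc, mul_comm, mul_smul, hσy r hr, smul_zero]
    simpa using hle hr
  · have := congrArg f hr
    rw [map_smul, map_smul, map_zero, smul_smul, ← hy] at this
    exact (Ideal.IsPrime.mem_or_mem ‹_› this).resolve_right hs

lemma exists_smul_eq_zero_of_pow [p.IsPrime] {E : Type*} [AddCommGroup E] [Module R E] {x : R}
    (h : ∀ y : E, x • y = 0 → ∃ s ∉ p, s • y = 0) (m : ℕ) :
    ∀ y : E, x ^ m • y = 0 → ∃ s ∉ p, s • y = 0 := by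
  induction m with
  | zero =>
    exact fun y hy => ⟨1, p.one_notMem, by simpa using hy⟩
  | succ m ih =>
    intro y hy
    obtain ⟨s, hs, hsy⟩ := ih (x • y) (by rwa [smul_smul, ← pow_succ])
    obtain ⟨s', hs', h'⟩ := h (s • y) (by rwa [smul_comm])
    exact ⟨s' * s, Ideal.IsPrime.mul_notMem ‹_› hs' hs, by rwa [mul_smul]⟩

/-- If `x` avoids all associated primes contained in `p`, then `x` is injective up to elements
killed by a single scalar outside `p`. -/
lemma exists_smul_eq_zero_of_notMem_associatedPrimes [IsNoetherianRing R] [p.IsPrime] {N : Type*}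
    [AddCommGroup N] [Module R N] [Module.Finite R N] {x : R}
    (hx : ∀ q ∈ associatedPrimes R N, q ≤ p → x ∉ q) :
    ∃ s ∉ p, ∀ y : N, x • y = 0 → s • y = 0 := by
  let K := LinearMap.ker (LinearMap.lsmul R N x)
  have hK : ¬ Module.annihilator R K ≤ p := fun hle => by
    obtain ⟨q, hq, hqp⟩ := Ideal.exists_minimalPrimes_le hle
    have hqK := Module.associatedPrimes.minimalPrimes_annihilator_subset_associatedPrimes R K hq
    refine hx q (hqK.map_of_injective K.subtype K.injective_subtype) hqp (hq.1.2 ?_)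
    rw [Module.mem_annihilator]
    exact fun y => Subtype.ext y.2
  obtain ⟨s, hs, hsp⟩ := SetLike.not_le_iff_exists.1 hK
  exact ⟨s, hsp, fun y hy => congrArg Subtype.val (Module.mem_annihilator.1 hs ⟨y, hy⟩)⟩

end AssociatedPrimes

section Shift

variable {R : Type} [CommRing R] (X : ChainComplex (ModuleCat.{0} R) ℕ)

lemma smul_homCohomology_of_smul {Y : ModuleCat.{0} R} {s : R} (hs : ∀ y : Y, s • y = 0) (n : ℕ)
    (z : (homCohomology X n).obj Y) : s • z = 0 := by
  have h : s • 𝟙 Y = 0 := ModuleCat.hom_ext (LinearMap.ext hs)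
  have := homCohomology_map_smul_id X Y s n
  rw [h, Functor.map_zero] at this
  exact (congrArg (fun f => f.hom z) this).symm

lemma homCohomology_map_eq_zero_iff [∀ i, Projective (X.X i)] {S : ShortComplex (ModuleCat.{0} R)}
    (hS : S.ShortExact) (n : ℕ) (y : (homCohomology X n).obj S.X₂) :
    (homCohomology X n).map S.g y = 0 ↔ ∃ z, (homCohomology X n).map S.f z = y :=
  (ShortComplex.ShortExact.moduleCat_exact_iff_function_exact _).1
    ((homComplex_shortExact X hS).homology_exact₂ n) y

lemma exists_connecting [∀ i, Projective (X.X i)] {S : ShortComplex (ModuleCat.{0} R)}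
    (hS : S.ShortExact) (n : ℕ) :
    ∃ δ : (homCohomology X n).obj S.X₃ →ₗ[R] (homCohomology X (n + 1)).obj S.X₁,
      (∀ c, δ c = 0 ↔ ∃ y, (homCohomology X n).map S.g y = c) ∧
      ∀ z, (homCohomology X (n + 1)).map S.f z = 0 ↔ ∃ c, δ c = z :=
  ⟨((homComplex_shortExact X hS).δ n (n + 1) rfl).hom,
    (ShortComplex.ShortExact.moduleCat_exact_iff_function_exact _).1
      ((homComplex_shortExact X hS).homology_exact₃ n (n + 1) rfl),
    (ShortComplex.ShortExact.moduleCat_exact_iff_function_exact _).1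
      ((homComplex_shortExact X hS).homology_exact₁ n (n + 1) rfl)⟩

variable {p : Ideal R}

/-- For `C = N / xN` with `x` injective on `N` up to `p`-torsion, the connecting maps of the
cohomology of `Hom(X, -)`, factoring the multiplication by `x` on `N` through its image. -/
lemma exists_connecting_of_mul [∀ i, Projective (X.X i)] {N C : ModuleCat.{0} R} {x : R}
    (g : N ⟶ C) (hg : Function.Surjective g) (hgx : ∀ y, g y = 0 ↔ ∃ z, x • z = y)
    (hx : ∃ s ∉ p, ∀ y : N, x • y = 0 → s • y = 0) (n : ℕ) :
    ∃ (Q : ModuleCat.{0} R)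
      (α : (homCohomology X (n + 1)).obj N →ₗ[R] (homCohomology X (n + 1)).obj Q)
      (β : (homCohomology X (n + 1)).obj Q →ₗ[R] (homCohomology X (n + 1)).obj N)
      (δ : (homCohomology X n).obj C →ₗ[R] (homCohomology X (n + 1)).obj Q),
      (∀ y, β (α y) = x • y) ∧ (∀ y, α y = 0 → ∃ s ∉ p, s • y = 0) ∧
      (∀ z, ∃ s ∉ p, ∃ y, α y = s • z) ∧
      (∀ c, δ c = 0 ↔ ∃ y, (homCohomology X n).map g y = c) ∧ ∀ z, β z = 0 ↔ ∃ c, δ c = z := by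
  obtain ⟨s, hs, hsx⟩ := hx
  let m : N →ₗ[R] N := LinearMap.lsmul R N x
  let S₁ : ShortComplex (ModuleCat.{0} R) :=
    ShortComplex.mk (ModuleCat.ofHom (LinearMap.ker m).subtype) (ModuleCat.ofHom m.rangeRestrict)
      (ModuleCat.hom_ext (LinearMap.ext fun y => Subtype.ext y.2))
  let S₂ : ShortComplex (ModuleCat.{0} R) :=
    ShortComplex.mk (ModuleCat.ofHom (LinearMap.range m).subtype) g
      (ModuleCat.hom_ext (LinearMap.ext fun y => (hgx _).2 y.2))
  have h₁ : S₁.ShortExact :=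
    { exact := (ShortComplex.moduleCat_exact_iff _).2 fun y hy =>
        ⟨⟨y, congrArg Subtype.val hy⟩, rfl⟩
      mono_f := (ModuleCat.mono_iff_injective _).2 (Submodule.injective_subtype _)
      epi_g := (ModuleCat.epi_iff_surjective _).2 m.surjective_rangeRestrict }
  have h₂ : S₂.ShortExact :=
    { exact := (ShortComplex.moduleCat_exact_iff _).2 fun y hy => ⟨⟨y, (hgx y).1 hy⟩, rfl⟩
      mono_f := (ModuleCat.mono_iff_injective _).2 (Submodule.injective_subtype _)
      epi_g := (ModuleCat.epi_iff_surjective _).2 hg }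
  have hK (y : S₁.X₁) : s • y = 0 := Subtype.ext (hsx _ y.2)
  obtain ⟨δ, hδ, hδβ⟩ := exists_connecting X h₂ n
  obtain ⟨δ', hδ', -⟩ := exists_connecting X h₁ (n + 1)
  refine ⟨S₂.X₁, ((homCohomology X (n + 1)).map S₁.g).hom, ((homCohomology X (n + 1)).map S₂.f).hom,
    δ, fun y => ?_, fun y hy => ?_, fun z => ⟨s, hs, ?_⟩, hδ, hδβ⟩
  · have hm : S₁.g ≫ S₂.f = x • 𝟙 N := rfl
    have := (homCohomology X (n + 1)).map_comp S₁.g S₂.f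
    rw [hm, homCohomology_map_smul_id] at this
    exact (congrArg (fun f => f.hom y) this).symm
  · obtain ⟨z, rfl⟩ := (homCohomology_map_eq_zero_iff X h₁ (n + 1) y).1 hy
    refine ⟨s, hs, ?_⟩
    rw [← map_smul, smul_homCohomology_of_smul X hK, map_zero]
  · refine (hδ' _).1 ?_
    rw [map_smul]
    exact smul_homCohomology_of_smul X hK _ _

/-- The `p`-torsion of the cohomology of `Hom(X, N / xN)` passes to `Hom(X, N)` one degree up. -/
lemma isTorsion_homCohomology_succ [p.IsPrime] [∀ i, Projective (X.X i)] {N C : ModuleCat.{0} R} {x : R}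
    (g : N ⟶ C) (hg : Function.Surjective g) (hgx : ∀ y, g y = 0 ↔ ∃ z, x • z = y)
    (hx : ∃ s ∉ p, ∀ y : N, x • y = 0 → s • y = 0) {n m : ℕ}
    (hm : ∀ z : (homCohomology X (n + 1)).obj N, x ^ m • z = 0)
    (hC : ∀ c : (homCohomology X n).obj C, ∃ s ∉ p, s • c = 0)
    (z : (homCohomology X (n + 1)).obj N) : ∃ s ∉ p, s • z = 0 := by
  obtain ⟨Q, α, β, δ, hβα, hα, -, -, hβ⟩ := exists_connecting_of_mul X g hg hgx hx n
  refine exists_smul_eq_zero_of_pow (fun y hy => ?_) m z (hm z)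
  rw [← hβα, hβ] at hy
  obtain ⟨c, hc⟩ := hy
  obtain ⟨s, hs, hsc⟩ := hC c
  obtain ⟨s', hs', h'⟩ := hα (s • y) (by rw [map_smul, ← hc, ← map_smul, hsc, map_zero])
  exact ⟨s' * s, Ideal.IsPrime.mul_notMem ‹_› hs' hs, by rwa [mul_smul]⟩

lemma mem_associatedPrimes_homCohomology_succ_iff [IsNoetherianRing R] [p.IsPrime] [∀ i, Projective (X.X i)]
    {N C : ModuleCat.{0} R} {x : R}
    (g : N ⟶ C) (hg : Function.Surjective g) (hgx : ∀ y, g y = 0 ↔ ∃ z, x • z = y)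
    (hx : ∃ s ∉ p, ∀ y : N, x • y = 0 → s • y = 0) (hxp : x ∈ p) {n : ℕ}
    (hN : ∀ y : (homCohomology X n).obj N, ∃ s ∉ p, s • y = 0) :
    p ∈ associatedPrimes R ((homCohomology X (n + 1)).obj N) ↔
      p ∈ associatedPrimes R ((homCohomology X n).obj C) := by
  obtain ⟨Q, α, β, δ, hβα, hα, hα', hδ, hβ⟩ := exists_connecting_of_mul X g hg hgx hx n
  have hδ' (c) (hc : δ c = 0) : ∃ s ∉ p, s • c = 0 := by
    obtain ⟨y, rfl⟩ := (hδ c).1 hc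
    obtain ⟨s, hs, hsy⟩ := hN y
    exact ⟨s, hs, by rw [← map_smul, hsy, map_zero]⟩
  simp only [mem_associatedPrimes_iff_exists, ‹p.IsPrime›, true_and]
  constructor
  · rintro ⟨y, hy⟩
    obtain ⟨c, hc⟩ := (hβ (α y)).1 (by rw [hβα, ← hy]; exact hxp)
    exact exists_mem_iff_smul_eq_zero_of_map δ hδ' (hc ▸ mem_iff_smul_map_eq_zero α hα hy)
  · rintro ⟨c, hc⟩
    obtain ⟨s, hs, y, hy⟩ := hα' (δ c)
    refine exists_mem_iff_smul_eq_zero_of_map α hα (y := y) fun r => ?_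
    rw [hy, smul_smul, ← mem_iff_smul_map_eq_zero δ hδ' hc]
    exact ⟨fun hr => p.mul_mem_right _ hr,
      fun hr => (Ideal.IsPrime.mem_or_mem ‹_› hr).resolve_right hs⟩

end Shift

section Quotient

variable {R : Type} [CommRing R] {p J : Ideal R}
  (P : ProjectiveResolution (ModuleCat.of R (R ⧸ J)))

lemma exists_homCohomology_zero_quotient (N : ModuleCat.{0} R) :
    ∃ f : (homCohomology P.complex 0).obj N →ₗ[R] N, Function.Injective f ∧
      ∀ y, (∀ r ∈ J, r • y = 0) → ∃ z, f z = y := by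
  obtain ⟨e⟩ := nonempty_homCohomology_zero_equiv P N
  let ev : (ModuleCat.of R (R ⧸ J) ⟶ N) →ₗ[R] N :=
    { toFun := fun u => u.hom (Submodule.Quotient.mk (1 : R))
      map_add' := fun _ _ => rfl
      map_smul' := fun _ _ => rfl }
  have hev : Function.Injective ev := fun u v huv =>
    ModuleCat.hom_ext (LinearMap.ext fun y => by
      obtain ⟨r, rfl⟩ := Submodule.Quotient.mk_surjective _ y
      have hr : (Submodule.Quotient.mk r : R ⧸ J) = r • Submodule.Quotient.mk (1 : R) := by
        rw [← Submodule.Quotient.mk_smul, smul_eq_mul, mul_one]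
      rw [hr, map_smul, map_smul]
      exact congrArg (r • ·) huv)
  refine ⟨ev ∘ₗ e.toLinearMap, hev.comp e.injective, fun y hy => ?_⟩
  refine ⟨e.symm (ModuleCat.ofHom (J.liftQ (LinearMap.toSpanSingleton R N y) fun r hr =>
    hy r hr)), ?_⟩
  rw [LinearMap.comp_apply, LinearEquiv.coe_coe, LinearEquiv.apply_symm_apply]
  exact one_smul R y

lemma smul_homCohomology_quotient_eq_zero {r : R} (hr : r ∈ J) {N : ModuleCat.{0} R} {n : ℕ}
    (z : (homCohomology P.complex n).obj N) : r • z = 0 := by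
  refine smul_homCohomology_eq_zero P (fun y => ?_) N n z
  obtain ⟨u, rfl⟩ := Submodule.Quotient.mk_surjective _ y
  rw [← Submodule.Quotient.mk_smul, Submodule.Quotient.mk_eq_zero]
  exact J.mul_mem_right u hr

variable [IsNoetherianRing R]

lemma mem_associatedPrimes_homCohomology_zero_iff (hJ : J ≤ p) (N : ModuleCat.{0} R) :
    p ∈ associatedPrimes R ((homCohomology P.complex 0).obj N) ↔ p ∈ associatedPrimes R N := by
  obtain ⟨f, hf, hfJ⟩ := exists_homCohomology_zero_quotient P N
  refine ⟨fun h => h.map_of_injective f hf, fun h => ?_⟩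
  rw [mem_associatedPrimes_iff_exists] at h ⊢
  obtain ⟨hp, y, hy⟩ := h
  obtain ⟨z, rfl⟩ := hfJ y fun r hr => (hy r).1 (hJ hr)
  exact ⟨hp, z, fun r => by rw [hy, ← map_smul, map_eq_zero_iff f hf]⟩

lemma le_of_mem_associatedPrimes_homCohomology {N : ModuleCat.{0} R} {n : ℕ}
    (h : p ∈ associatedPrimes R ((homCohomology P.complex n).obj N)) : J ≤ p := by
  obtain ⟨-, y, hy⟩ := mem_associatedPrimes_iff_exists.1 h
  exact fun r hr => (hy r).2 (smul_homCohomology_quotient_eq_zero P hr y)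

variable (p J) in
/-- `C` is the quotient of `N` by an element of `p ⊓ √J` that is injective on `N` up to
elements killed by a single scalar outside `p`. -/
def IsRegularQuotientAt (N C : ModuleCat.{0} R) : Prop :=
  ∃ x ∈ p, x ∈ J.radical ∧ (∃ s ∉ p, ∀ y : N, x • y = 0 → s • y = 0) ∧
    ∃ g : N ⟶ C, Function.Surjective g ∧ ∀ y, g y = 0 ↔ ∃ z, x • z = y

variable [p.IsPrime]

omit [IsNoetherianRing R] in
lemma isTorsion_homCohomology_of_isRegularQuotientAt (M : ℕ → ModuleCat.{0} R) (j : ℕ) :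
    ∀ i, (∀ i', i ≤ i' → i' ≤ i + j → IsRegularQuotientAt p J (M i') (M (i' + 1))) →
      ∀ z : (homCohomology P.complex j).obj (M i), ∃ s ∉ p, s • z = 0 := by
  induction j with
  | zero =>
    intro i h z
    obtain ⟨x, -, ⟨m, hm⟩, ⟨s, hs, hsx⟩, -⟩ := h i le_rfl le_rfl
    obtain ⟨f, hf, -⟩ := exists_homCohomology_zero_quotient P (M i)
    refine exists_smul_eq_zero_of_pow (fun y hy => ⟨s, hs, hf ?_⟩) m z
      (smul_homCohomology_quotient_eq_zero P hm z)
    rw [map_smul, map_zero]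
    exact hsx _ (by rw [← map_smul, hy, map_zero])
  | succ j ih =>
    intro i h
    obtain ⟨x, -, ⟨m, hm⟩, hx, g, hg, hgx⟩ := h i le_rfl (by omega)
    exact isTorsion_homCohomology_succ P.complex g hg hgx hx
      (smul_homCohomology_quotient_eq_zero P hm)
      (ih (i + 1) fun i' h₁ h₂ => h i' (by omega) (by omega))

lemma mem_associatedPrimes_homCohomology_iff (hJ : J ≤ p) (M : ℕ → ModuleCat.{0} R) (j : ℕ) :
    ∀ i, (∀ i', i ≤ i' → i' < i + j → IsRegularQuotientAt p J (M i') (M (i' + 1))) →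
      (p ∈ associatedPrimes R ((homCohomology P.complex j).obj (M i)) ↔
        p ∈ associatedPrimes R (M (i + j))) := by
  induction j with
  | zero => exact fun i _ => mem_associatedPrimes_homCohomology_zero_iff P hJ (M i)
  | succ j ih =>
    intro i h
    obtain ⟨x, hxp, -, hx, g, hg, hgx⟩ := h i le_rfl (by omega)
    rw [mem_associatedPrimes_homCohomology_succ_iff P.complex g hg hgx hx hxp
      (isTorsion_homCohomology_of_isRegularQuotientAt P M j i
        fun i' h₁ h₂ => h i' h₁ (by omega)),
      ih (i + 1) fun i' h₁ h₂ => h i' (by omega) (by omega), add_right_comm, add_assoc]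

end Quotient

section Ext

variable {R : Type} [CommRing R]

lemma prefIdeal_succ {r : ℕ} (x : Fin r → R) (i : Fin r) :
    prefIdeal x (i + 1) = prefIdeal x i ⊔ Ideal.span {x i} := by
  rw [prefIdeal, prefIdeal, ← Ideal.span_union, ← Set.image_singleton, ← Set.image_union]
  congr 2
  ext i'
  simp only [Set.mem_ofPred_eq, Set.mem_union, Set.mem_singleton_iff, Fin.ext_iff]
  omega

lemma zdim_lt_of_lt {k : ℤ} {p q : Ideal R} [q.IsPrime] [p.IsPrime] (hqp : q < p)
    (hp : zdim k ≤ ringKrullDim (R ⧸ p)) : zdim k < ringKrullDim (R ⧸ q) := by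
  have hsucc : ringKrullDim (R ⧸ p) + 1 ≤ ringKrullDim (R ⧸ q) := by
    obtain ⟨y, hyp, hyq⟩ := SetLike.exists_of_lt hqp
    refine ringKrullDim_succ_le_of_surjective (Ideal.Quotient.factor hqp.le)
      (Ideal.Quotient.factor_surjective hqp.le) (r := Ideal.Quotient.mk q y)
      (mem_nonZeroDivisors_of_ne_zero ?_) ?_
    · rwa [Ne, Ideal.Quotient.eq_zero_iff_mem]
    · rwa [Ideal.Quotient.factor_mk, Ideal.Quotient.eq_zero_iff_mem]
  refine lt_of_lt_of_le ?_ hsucc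
  have hp₀ : (0 : WithBot ℕ∞) ≤ ringKrullDim (R ⧸ p) := ringKrullDim_nonneg_of_nontrivial
  rw [zdim] at hp ⊢
  split_ifs at hp ⊢ with hk
  · exact (WithBot.bot_lt_coe 0).trans_le (hp₀.trans (le_add_of_nonneg_right zero_le_one))
  · refine lt_of_lt_of_le (b := ((k.toNat : ℕ∞) : WithBot ℕ∞) + 1) ?_ (add_le_add_left hp 1)
    exact WithBot.coe_lt_coe.2 ((Nat.cast_lt (α := ℕ∞)).2 k.toNat.lt_succ_self)

variable [IsNoetherianRing R] {N : Type} [AddCommGroup N] [Module R N] [Module.Finite R N]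
  {k : ℤ} {r : ℕ} {x : Fin r → R}

lemma isRegularQuotientAt_prefIdeal (hx : IsSeqInDimGT R N k x) {p J : Ideal R} [p.IsPrime]
    (hp : p ∈ dimGE R k) (hJ : J ≤ p) (hxJ : ∀ i, x i ∈ J.radical) (i : Fin r)
    (hpi : p ∉ associatedPrimes R (N ⧸ (prefIdeal x i • ⊤ : Submodule R N))) :
    IsRegularQuotientAt p J (ModuleCat.of R (N ⧸ (prefIdeal x i • ⊤ : Submodule R N)))
      (ModuleCat.of R (N ⧸ (prefIdeal x (i + 1) • ⊤ : Submodule R N))) := by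
  have hle : (prefIdeal x i • ⊤ : Submodule R N) ≤ prefIdeal x (i + 1) • ⊤ :=
    Submodule.smul_mono_left (by rw [prefIdeal_succ]; exact le_sup_left)
  have hxp : x i ∈ p := (Ideal.IsPrime.radical_le_iff ‹_›).2 hJ (hxJ i)
  refine ⟨x i, hxp, hxJ i,
    exists_smul_eq_zero_of_notMem_associatedPrimes fun q hq hqp => ?_,
    ModuleCat.ofHom (Submodule.factor hle), Submodule.factor_surjective hle, fun y => ?_⟩
  · have := hq.isPrime
    exact hx i q hq (zdim_lt_of_lt (lt_of_le_of_ne hqp fun h => hpi (h ▸ hq)) hp)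
  · obtain ⟨y, rfl⟩ := Submodule.Quotient.mk_surjective _ y
    change (Submodule.Quotient.mk y : N ⧸ (prefIdeal x (i + 1) • ⊤ : Submodule R N)) = 0 ↔ _
    rw [Submodule.Quotient.mk_eq_zero, prefIdeal_succ, Submodule.sup_smul,
      Submodule.ideal_span_singleton_smul, Submodule.mem_sup]
    constructor
    · rintro ⟨u, hu, v, hv, rfl⟩
      obtain ⟨w, -, rfl⟩ := (Submodule.mem_smul_pointwise_iff_exists _ _ _).1 hv
      refine ⟨Submodule.Quotient.mk w, ?_⟩
      rw [Submodule.Quotient.mk_add, (Submodule.Quotient.mk_eq_zero _).2 hu, zero_add]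
      rfl
    · rintro ⟨z, hz⟩
      obtain ⟨w, rfl⟩ := Submodule.Quotient.mk_surjective _ z
      rw [← Submodule.Quotient.mk_smul, eq_comm, Submodule.Quotient.eq] at hz
      exact ⟨y - x i • w, hz, x i • w, Submodule.smul_mem_pointwise_smul _ _ _ trivial,
        sub_add_cancel _ _⟩

lemma iUnion_associatedPrimes_ext_eq (hx : IsSeqInDimGT R N k x) {I J : Ideal R}
    (hIJ : J.radical = I.radical) (hxI : ∀ i, x i ∈ I.radical) {l : ℕ} (hl : l ≤ r) :
    (⋃ j ≤ l, associatedPrimes R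
        (((Ext R (ModuleCat R) j).obj (op (ModuleCat.of R (R ⧸ J)))).obj (ModuleCat.of R N))
        ∩ dimGE R k)
      = (⋃ j ≤ l, (associatedPrimes R (N ⧸ (prefIdeal x j • ⊤ : Submodule R N))
          ∩ dimGE R k ∩ {p | I ≤ p})) := by
  have hxJ (i) : x i ∈ J.radical := hIJ ▸ hxI i
  have hle {p : Ideal R} (hp : p.IsPrime) : J ≤ p ↔ I ≤ p := by
    rw [← hp.radical_le_iff, hIJ, hp.radical_le_iff]
  let P : ProjectiveResolution (ModuleCat.of R (R ⧸ J)) := ProjectiveResolution.of _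
  let M (i : ℕ) : ModuleCat.{0} R := ModuleCat.of R (N ⧸ (prefIdeal x i • ⊤ : Submodule R N))
  have hM₀ : (prefIdeal x 0 • ⊤ : Submodule R N) = ⊥ := by simp [prefIdeal]
  let e : ModuleCat.of R N ≅ M 0 := (Submodule.quotEquivOfEqBot _ hM₀).symm.toModuleIso
  have hExt (j : ℕ) : associatedPrimes R
      (((Ext R (ModuleCat R) j).obj (op (ModuleCat.of R (R ⧸ J)))).obj (ModuleCat.of R N)) =
      associatedPrimes R ((homCohomology P.complex j).obj (M 0)) :=
    LinearEquiv.AssociatedPrimes.eq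
      (P.isoExt j (ModuleCat.of R N) ≪≫ (homCohomology P.complex j).mapIso e).toLinearEquiv
  ext p
  simp only [Set.mem_iUnion, Set.mem_inter_iff, Set.mem_ofPred_eq, exists_prop, hExt]
  have key (hp : p.IsPrime) (hpk : p ∈ dimGE R k) (hJ : J ≤ p) {j : ℕ} (hj : j ≤ l)
      (h : ∀ i < j, p ∉ associatedPrimes R (M i)) :
      p ∈ associatedPrimes R ((homCohomology P.complex j).obj (M 0)) ↔
        p ∈ associatedPrimes R (M j) := by
    have := mem_associatedPrimes_homCohomology_iff P hJ M j 0 fun i _ hi =>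
      isRegularQuotientAt_prefIdeal hx hpk hJ hxJ ⟨i, by omega⟩ (h i (by omega))
    rwa [zero_add] at this
  constructor
  · rintro ⟨j, hj, hp, hpk⟩
    have hJ : J ≤ p := le_of_mem_associatedPrimes_homCohomology P hp
    by_contra! hcon
    exact hcon j hj ⟨(key hp.isPrime hpk hJ hj fun i hi h => hcon i (by omega) ⟨h, hpk⟩
      ((hle hp.isPrime).1 hJ)).1 hp, hpk⟩ ((hle hp.isPrime).1 hJ)
  · rintro ⟨j, hj, ⟨hp, hpk⟩, hJ⟩
    classical
    have hex : ∃ i, p ∈ associatedPrimes R (M i) := ⟨j, hp⟩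
    have hfind : Nat.find hex ≤ l := (Nat.find_min' hex hp).trans hj
    exact ⟨_, hfind, (key hp.isPrime hpk ((hle hp.isPrime).2 hJ) hfind fun i hi => Nat.find_min hex hi).2
      (Nat.find_spec hex), hpk⟩

end Ext

/-- Corollary: with `r = depth_k(I,N) < ∞`, `x₁,…,x_r` an `N`-sequence in dimension `> k` in
`√I` and `a₁,…,a_s` generators of `I`, for all positive `t, t₁,…,t_s` and all `l ≤ r`:
`⋃_{j≤l} Ass(Ext^j(R/I^t,N))_{≥k} = ⋃_{j≤l} Ass(N/(x₁,…,x_j)N)_{≥k} ∩ V(I)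
  = ⋃_{j≤l} Ass(Ext^j(R/(a₁^{t₁},…,a_s^{t_s}),N))_{≥k}`. -/
theorem ass_ext_powers_eq (R : Type) [CommRing R] [IsNoetherianRing R] [IsLocalRing R]
    (I : Ideal R) (N : Type) [AddCommGroup N] [Module R N] [Module.Finite R N]
    (k : ℤ) (hk : -1 ≤ k) (r : ℕ) (hr : depthK R k I N = (r : ℕ∞))
    (x : Fin r → R) (hxI : ∀ i, x i ∈ I.radical) (hx : IsSeqInDimGT R N k x)
    (s : ℕ) (a : Fin s → R) (ha : Ideal.span (Set.range a) = I)
    (t : ℕ) (ht : 0 < t) (ts : Fin s → ℕ) (hts : ∀ i, 0 < ts i)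
    (l : ℕ) (hl : l ≤ r) :
    (⋃ j ≤ l, associatedPrimes R
        (((Ext R (ModuleCat R) j).obj (op (ModuleCat.of R (R ⧸ I ^ t)))).obj (ModuleCat.of R N))
        ∩ dimGE R k)
      = (⋃ j ≤ l, (associatedPrimes R (N ⧸ (prefIdeal x j • ⊤ : Submodule R N))
          ∩ dimGE R k ∩ {p | I ≤ p}))
    ∧ (⋃ j ≤ l, associatedPrimes R
        (((Ext R (ModuleCat R) j).obj
          (op (ModuleCat.of R (R ⧸ Ideal.span (Set.range fun i => a i ^ ts i))))).obj
          (ModuleCat.of R N))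
        ∩ dimGE R k)
      = (⋃ j ≤ l, (associatedPrimes R (N ⧸ (prefIdeal x j • ⊤ : Submodule R N))
          ∩ dimGE R k ∩ {p | I ≤ p})) := by
  refine ⟨iUnion_associatedPrimes_ext_eq hx (I.radical_pow ht.ne') hxI hl,
    iUnion_associatedPrimes_ext_eq hx (le_antisymm ?_ ?_) hxI hl⟩
  · refine Ideal.radical_mono (Ideal.span_le.2 ?_)
    rintro _ ⟨i, rfl⟩
    refine I.pow_mem_of_mem ?_ _ (hts i)
    rw [← ha]
    exact Ideal.subset_span ⟨i, rfl⟩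
  · rw [Ideal.radical_le_radical_iff, ← ha, Ideal.span_le]
    rintro _ ⟨i, rfl⟩
    exact ⟨ts i, Ideal.subset_span ⟨i, rfl⟩⟩
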